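/- arXiv:2509.07303 — 3 statements merged into one kernel-verified Lean document; each statement's English description precedes it below -/
import Mathlib

section
/- Let d ≤ p be positive integers and let D ∈ ℝ^{d×p} be a dimension matrix whose first d columns form an invertible matrix A ∈ ℝ^{d×d}. Let e ∈ ℝ^d and suppose f : (0,∞)^p → ℝ is dimensionally covariant with output dimension vector e, i.e. f(λ·x) = (∏_{k=1}^d λ_k^{e_k}) f(x) for all λ ∈ (0,∞)^d and x ∈ (0,∞)^p. Define q = A⁻¹e ∈ ℝ^d and, for each i = 1,…,p−d, q_i = A⁻¹ D_{·,d+i} ∈ ℝ^d (where D_{·,d+i} is the (d+i)-th column of D). Then there exists a function g : (0,∞)^{p−d} → ℝ such that for all x ∈ (0,∞)^p, f(x) = (∏_{j=1}^d x_j^{q_j}) · g(Π_1, …, Π_{p−d}), where Π_i = x_{d+i} · ∏_{j=1}^d x_j^{−(q_i)_j} are dimensionless quantities (Buckingham Π theorem). -/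
/-- Iterated monomial maps on positive vectors compose by matrix-vector multiplication. -/
theorem prod_prod_rpow_eq_prod_rpow_mulVec {m n : Type*} [Fintype m] [Fintype n]
    (M : Matrix m n ℝ) (v : n → ℝ) {y : m → ℝ} (hy : ∀ j, 0 < y j) :
    ∏ k, (∏ j, y j ^ M j k) ^ v k = ∏ j, y j ^ M.mulVec v j := by
  simp_rw [← Real.finsetProd_rpow _ _ (fun j _ => (Real.rpow_pos_of_pos (hy j) _).le),
    ← Real.rpow_mul (hy _).le]
  rw [Finset.prod_comm]
  refine Finset.prod_congr rfl fun j _ => ?_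
  rw [Matrix.mulVec, dotProduct, Real.rpow_sum_of_pos (hy j)]

/-- **Buckingham Π theorem.** Let `D : ℝ^{d×p}` be a dimension matrix whose first `d`
columns form an invertible matrix `A`, and let `f : (0,∞)^p → ℝ` be dimensionally
covariant with output dimension vector `e`, i.e.
`f (λ·x) = (∏ k, λ k ^ e k) * f x` where `(λ·x)_j = x_j * ∏ k, λ_k ^ D_{kj}`.
With `q = A⁻¹ e` and `qᵢ = A⁻¹ D_{·,d+i}`, there is a function `g : (0,∞)^{p-d} → ℝ`
such that `f x = (∏_{j<d} x_j ^ q_j) * g (Π_1, …, Π_{p-d})`, where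
`Π_i = x_{d+i} * ∏_{j<d} x_j ^ (-(qᵢ)_j)` are dimensionless. -/
theorem buckingham_pi (d p : ℕ) (hd : 0 < d) (hdp : d ≤ p)
    (D : Matrix (Fin d) (Fin p) ℝ) (e : Fin d → ℝ)
    (A : Matrix (Fin d) (Fin d) ℝ)
    (hA : ∀ k j : Fin d, A k j = D k (Fin.castLE hdp j))
    (hAinv : IsUnit A.det)
    (f : (Fin p → ℝ) → ℝ)
    (hcov : ∀ lam : Fin d → ℝ, (∀ k, 0 < lam k) →
      ∀ x : Fin p → ℝ, (∀ j, 0 < x j) →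
        f (fun j => x j * ∏ k, lam k ^ D k j) = (∏ k, lam k ^ e k) * f x) :
    ∃ g : (Fin (p - d) → ℝ) → ℝ,
      ∀ x : Fin p → ℝ, (∀ j, 0 < x j) →
        f x = (∏ j : Fin d, x (Fin.castLE hdp j) ^ A⁻¹.mulVec e j) *
          g (fun i : Fin (p - d) =>
            x ⟨d + i.val, by omega⟩ *
              ∏ j : Fin d,
                x (Fin.castLE hdp j) ^
                  (-(A⁻¹.mulVec (fun k => D k ⟨d + i.val, by omega⟩) j))) := by
  let g : (Fin (p - d) → ℝ) → ℝ := fun y =>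
    f fun j => if h : j.val < d then 1 else y ⟨j.val - d, by omega⟩
  refine ⟨g, fun x hx => ?_⟩
  set y : Fin d → ℝ := fun j => x (Fin.castLE hdp j)
  have hy : ∀ j, 0 < y j := fun j => hx _
  set lam : Fin d → ℝ := fun k => ∏ j, y j ^ (-A⁻¹) j k
  have hlam : ∀ k, 0 < lam k := fun k =>
    Finset.prod_pos fun j _ => Real.rpow_pos_of_pos (hy j) _
  have hmonomial : ∀ v : Fin d → ℝ, ∏ k, lam k ^ v k = ∏ j, y j ^ (-A⁻¹.mulVec v j) := fun v => by
    rw [prod_prod_rpow_eq_prod_rpow_mulVec _ _ hy, Matrix.neg_mulVec]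
    rfl
  have hcol : ∀ i : Fin d, ∏ k, lam k ^ D k (Fin.castLE hdp i) = (y i)⁻¹ := fun i => by
    have hbasis : A⁻¹.mulVec (fun k => D k (Fin.castLE hdp i)) = Pi.single i 1 := by
      have hAcol : (fun k => D k (Fin.castLE hdp i)) = A.mulVec (Pi.single i 1) := by
        ext k
        simp [hA]
      rw [hAcol, Matrix.mulVec_mulVec, Matrix.nonsing_inv_mul _ hAinv, Matrix.one_mulVec]
    rw [hmonomial, hbasis, Finset.prod_eq_single i]
    · simp [Real.rpow_neg_one]
    · intro j _ hj
      simp [Pi.single_eq_of_ne hj]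
    · simp
  have hscale := hcov lam hlam x hx
  have hnormal : (fun j => x j * ∏ k, lam k ^ D k j) = fun j : Fin p =>
      if h : j.val < d then 1 else
        x ⟨d + (j.val - d), by omega⟩ * ∏ i : Fin d, y i ^
          (-(A⁻¹.mulVec (fun k => D k ⟨d + (j.val - d), by omega⟩) i)) := by
    ext j
    split_ifs with h
    · have hj := hcol ⟨j, h⟩
      have hcast : Fin.castLE hdp ⟨j, h⟩ = j := rfl
      rw [hcast] at hj
      rw [hj]
      exact mul_inv_cancel₀ (hx j).ne'
    · have hj : (⟨d + (j.val - d), by omega⟩ : Fin p) = j := Fin.ext (by simp; omega)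
      rw [hmonomial, hj]
  rw [hnormal, hmonomial] at hscale
  change f x = (∏ j, y j ^ A⁻¹.mulVec e j) * f _
  rw [hscale, ← mul_assoc, ← Finset.prod_mul_distrib]
  simp [← Real.rpow_add (hy _)]
end

section
/- Let d ≤ p be positive integers, let D ∈ ℝ^{d×p} have its first d columns forming an invertible matrix A ∈ ℝ^{d×d}, let e ∈ ℝ^d, and suppose f : (0,∞)^p → ℝ is dimensionally covariant with output dimension vector e. Then there exist a weight matrix W ∈ ℝ^{(p−d+1)×p} and a function F : (0,∞)^{p−d+1} → ℝ such that for all x ∈ (0,∞)^p, f(x) = F(z_1(x), …, z_{p−d+1}(x)), where each latent variable is the power product z_i(x) = ∏_{j=1}^p x_j^{W_{ij}}. In particular, f can be expressed as a function of at most p − d + 1 power-product latent variables. -/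
/-- A power product of power products is the power product whose weights are combined linearly. -/
lemma prod_powerProduct_rpow {ι κ : Type*} [Fintype ι] [Fintype κ] (L : κ → ι → ℝ) (c : κ → ℝ)
    {x : ι → ℝ} (hx : ∀ j, 0 < x j) :
    ∏ k, (∏ j, x j ^ L k j) ^ c k = ∏ j, x j ^ ∑ k, c k * L k j := by
  have inner (k : κ) : (∏ j, x j ^ L k j) ^ c k = ∏ j, x j ^ (c k * L k j) := by
    rw [← Real.finsetProd_rpow _ _ fun j _ => (Real.rpow_pos_of_pos (hx j) _).le]
    exact Finset.prod_congr rfl fun j _ => by rw [← Real.rpow_mul (hx j).le, mul_comm]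
  simp_rw [inner]
  rw [Finset.prod_comm]
  exact Finset.prod_congr rfl fun j _ => (Real.rpow_sum_of_pos (hx j) _ _).symm

/-- A single coordinate is the power product with the indicator weight vector. -/
lemma mul_powerProduct {ι : Type*} [Fintype ι] [DecidableEq ι] (i : ι) (w : ι → ℝ)
    {x : ι → ℝ} (hx : ∀ j, 0 < x j) :
    x i * ∏ j, x j ^ w j = ∏ j, x j ^ ((if j = i then 1 else 0) + w j) := by
  simp_rw [Real.rpow_add (hx _), Finset.prod_mul_distrib]
  simp [apply_ite]

/-- Corollary of the Buckingham Π theorem: a dimensionally covariant function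
`f : (0,∞)^p → ℝ` (with dimension matrix `D` whose first `d` columns form an
invertible matrix `A`, and output dimension vector `e`) can be expressed as a
function `F` of at most `p - d + 1` latent variables, each of which is a power
product `z_i(x) = ∏ j, x j ^ W i j`. -/
theorem latent_power_product_representation (d p : ℕ) (hd : 0 < d) (hdp : d ≤ p)
    (D : Matrix (Fin d) (Fin p) ℝ) (e : Fin d → ℝ)
    (A : Matrix (Fin d) (Fin d) ℝ)
    (hA : ∀ k j : Fin d, A k j = D k (Fin.castLE hdp j))
    (hAinv : IsUnit A.det)
    (f : (Fin p → ℝ) → ℝ)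
    (hcov : ∀ lam : Fin d → ℝ, (∀ k, 0 < lam k) →
      ∀ x : Fin p → ℝ, (∀ j, 0 < x j) →
        f (fun j => x j * ∏ k, lam k ^ D k j) = (∏ k, lam k ^ e k) * f x) :
    ∃ (W : Matrix (Fin (p - d + 1)) (Fin p) ℝ) (F : (Fin (p - d + 1) → ℝ) → ℝ),
      ∀ x : Fin p → ℝ, (∀ j, 0 < x j) →
        f x = F (fun i => ∏ j, x j ^ W i j) := by
  classical
  -- The rescaling with factors `∏ j, x j ^ L k j` sends the first `d` coordinates of `x` to `1`.
  let L : Fin d → Fin p → ℝ := fun k j => if h : (j : ℕ) < d then -A⁻¹ ⟨j, h⟩ k else 0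
  let V : Fin p → Fin p → ℝ := fun i j => (if j = i then 1 else 0) + ∑ k, D k i * L k j
  have hV (i : Fin p) (hi : (i : ℕ) < d) (j : Fin p) : V i j = 0 := by
    by_cases hj : (j : ℕ) < d
    · have hmul : ∑ k, A⁻¹ ⟨j, hj⟩ k * A k ⟨i, hi⟩ = if j = i then 1 else 0 := by
        rw [← Matrix.mul_apply, Matrix.nonsing_inv_mul A hAinv, Matrix.one_apply]
        simp [Fin.ext_iff]
      have hsum : ∑ k, D k i * L k j = -∑ k, A⁻¹ ⟨j, hj⟩ k * A k ⟨i, hi⟩ := by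
        rw [← Finset.sum_neg_distrib]
        refine Finset.sum_congr rfl fun k _ => ?_
        have hcol : A k ⟨i, hi⟩ = D k i := hA k ⟨i, hi⟩
        simp only [L, dif_pos hj, hcol]
        ring
      simp only [V, hsum, hmul, add_neg_cancel]
    · have hne : j ≠ i := by rintro rfl; exact hj hi
      simp [V, L, hj, hne]
  refine ⟨Fin.cons (fun j => -∑ k, e k * L k j) fun i => V ⟨d + i, by omega⟩,
    fun z => z 0 * f fun j => if h : (j : ℕ) < d then 1
      else z (Fin.succ ⟨j - d, by omega⟩), fun x hx => ?_⟩
  have hcovx := hcov (fun k => ∏ j, x j ^ L k j)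
    (fun k => Finset.prod_pos fun j _ => Real.rpow_pos_of_pos (hx j) _) x hx
  have hfactor : (∏ j, x j ^ (-∑ k, e k * L k j)) * ∏ j, x j ^ ∑ k, e k * L k j = 1 := by
    rw [← Finset.prod_mul_distrib]
    exact Finset.prod_eq_one fun j _ => by rw [← Real.rpow_add (hx j)]; simp
  simp only [prod_powerProduct_rpow L _ hx, mul_powerProduct _ _ hx] at hcovx
  have hpoint : (fun j : Fin p => if h : (j : ℕ) < d then 1
      else ∏ l, x l ^ V ⟨d + (j - d), by omega⟩ l) = fun i => ∏ j, x j ^ V i j := by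
    funext i
    split_ifs with hi
    · simp [hV i hi]
    · have hidx : (⟨d + (i - d), by omega⟩ : Fin p) = i := Fin.ext (by simp; omega)
      rw [hidx]
  simp only [Fin.cons_zero, Fin.cons_succ]
  rw [hpoint, hcovx, ← mul_assoc, hfactor, one_mul]
end

section
/- Let W ∈ ℝ^{s×p}, let z_i(x) = ∏_{j=1}^p x_j^{W_{ij}} for i = 1,…,s be power products on (0,∞)^p, let g : ℝ^s → ℝ be differentiable, and define y(x) = g(z_1(x), …, z_s(x)). Fix indices j ≠ k in {1,…,p} and i in {1,…,s}, and suppose x_j and x_k connect only to the latent variable z_i, i.e. W_{i'j} = 0 and W_{i'k} = 0 for every i' ≠ i. Let x ∈ (0,∞)^p be a point at which W_{ik} · z_i(x) · ∂g/∂z_i(z(x)) ≠ 0. Then the ratio of the quantities ρ_j = x_j · ∂y/∂x_j (x) and ρ_k = x_k · ∂y/∂x_k (x) is the constant ρ_j/ρ_k = W_{ij}/W_{ik}, independent of the point x. -/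
theorem hasDerivAt_powerProduct_update {ι : Type*} [Fintype ι] [DecidableEq ι]
    (w x : ι → ℝ) (hx : ∀ l, 0 < x l) (j : ι) :
    HasDerivAt (fun t : ℝ => ∏ l, Function.update x j t l ^ w l)
      (w j * (∏ l, x l ^ w l) / x j) (x j) := by
  have hfactor : (fun t : ℝ => ∏ l, Function.update x j t l ^ w l) =
      fun t => t ^ w j * ∏ l ∈ Finset.univ.erase j, x l ^ w l := by
    funext t
    rw [← Finset.mul_prod_erase _ _ (Finset.mem_univ j), Function.update_self]
    congr 1
    refine Finset.prod_congr rfl fun l hl => ?_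
    rw [Function.update_of_ne (Finset.ne_of_mem_erase hl)]
  rw [hfactor]
  refine ((Real.hasDerivAt_rpow_const (p := w j) (Or.inl (hx j).ne')).mul_const _).congr_deriv ?_
  rw [← Finset.mul_prod_erase _ _ (Finset.mem_univ j), Real.rpow_sub_one (hx j).ne']
  ring

theorem mul_deriv_comp_powerProduct {σ ι : Type*} [Fintype σ] [DecidableEq σ]
    [Fintype ι] [DecidableEq ι] (W : Matrix σ ι ℝ) (g : (σ → ℝ) → ℝ)
    (x : ι → ℝ) (hx : ∀ l, 0 < x l)
    (hg : DifferentiableAt ℝ g (fun m => ∏ l, x l ^ W m l))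
    (j : ι) (i : σ) (hW : ∀ m, m ≠ i → W m j = 0) :
    x j * deriv (fun t : ℝ => g (fun m => ∏ l, Function.update x j t l ^ W m l)) (x j) =
      W i j * ((∏ l, x l ^ W i l) *
        fderiv ℝ g (fun m => ∏ l, x l ^ W m l) (Pi.single i 1)) := by
  have hz : HasDerivAt (fun (t : ℝ) m => ∏ l, Function.update x j t l ^ W m l)
      (fun m => W m j * (∏ l, x l ^ W m l) / x j) (x j) :=
    hasDerivAt_pi.2 fun m => hasDerivAt_powerProduct_update (W m) x hx j
  have hsingle : (fun m => W m j * (∏ l, x l ^ W m l) / x j) =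
      (W i j * (∏ l, x l ^ W i l) / x j) • (Pi.single i 1 : σ → ℝ) := by
    funext m
    rcases eq_or_ne m i with rfl | hm
    · simp
    · simp [hW m hm, hm]
  have hy := HasFDerivAt.comp_hasDerivAt_of_eq (x j) hg.hasFDerivAt hz (by simp)
  have hd := hy.deriv
  rw [hsingle, map_smul, smul_eq_mul] at hd
  simp only [Function.comp_def] at hd
  rw [hd]
  field_simp [(hx j).ne']

/-- Latent-structure identification: if inputs `x_j` and `x_k` connect only to the
latent variable `z_i` (i.e. `W i' j = 0` and `W i' k = 0` for all `i' ≠ i`) in the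
two-stage composite `y x = g (z₁ x, …, z_s x)` with power products
`z_i x = ∏ j, x j ^ W i j` and differentiable `g`, then at any positive point where
`W i k * z_i x * ∂g/∂z_i (z x) ≠ 0`, the ratio of the attributes
`ρ_j = x j * ∂y/∂x_j` and `ρ_k = x k * ∂y/∂x_k` equals the constant `W i j / W i k`,
independent of the point `x`. -/
theorem attribute_ratio_constant (s p : ℕ) (W : Matrix (Fin s) (Fin p) ℝ)
    (g : (Fin s → ℝ) → ℝ) (hg : Differentiable ℝ g)
    (j k : Fin p) (hjk : j ≠ k) (i : Fin s)
    (hWj : ∀ i' : Fin s, i' ≠ i → W i' j = 0)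
    (hWk : ∀ i' : Fin s, i' ≠ i → W i' k = 0)
    (x : Fin p → ℝ) (hx : ∀ j', 0 < x j')
    (hne : W i k * (∏ j', x j' ^ W i j') *
      fderiv ℝ g (fun i' => ∏ j', x j' ^ W i' j') (Pi.single i 1) ≠ 0) :
    (x j * deriv (fun t : ℝ =>
        g (fun i' => ∏ j', Function.update x j t j' ^ W i' j')) (x j)) /
      (x k * deriv (fun t : ℝ =>
        g (fun i' => ∏ j', Function.update x k t j' ^ W i' j')) (x k))
      = W i j / W i k := by
  rw [mul_deriv_comp_powerProduct W g x hx (hg _) j i hWj,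
    mul_deriv_comp_powerProduct W g x hx (hg _) k i hWk]
  rw [mul_assoc] at hne
  exact mul_div_mul_right _ _ (right_ne_zero_of_mul hne)
end
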